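/- arXiv:2403.11546 — 6 statements merged into one kernel-verified Lean document; each statement's English description precedes it below -/
import Mathlib

section
/- Let X be a finite-dimensional real normed vector space, Ω ⊆ X a nonempty compact set, and r : X → ℝ^m Lipschitz on Ω with constant L > 0 with respect to a norm ‖·‖ on ℝ^m. Let (xⁱ)_{i∈ℕ} be a sequence in Ω such that for all indices i < l one has ‖r(xⁱ)_+‖/L ≤ ‖x^l − xⁱ‖ (each point satisfies all previously added norm-induced cuts). Then (xⁱ) has at least one accumulation point in Ω, and every accumulation point x* of (xⁱ) satisfies r(x*) ≤ 0 componentwise, i.e., x* is feasible for the problem min{f(x) : r(x) ≤ 0, x ∈ Ω}. -/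
/-- A copy of `Fin m → ℝ` to carry another norm. -/
def NormCopy (m : ℕ) : Type := Fin m → ℝ

instance normCopyGroup (m : ℕ) : AddCommGroup (NormCopy m) :=
  inferInstanceAs (AddCommGroup (Fin m → ℝ))

instance normCopyModule (m : ℕ) : Module ℝ (NormCopy m) :=
  inferInstanceAs (Module ℝ (Fin m → ℝ))

instance normCopyFin (m : ℕ) : FiniteDimensional ℝ (NormCopy m) :=
  inferInstanceAs (FiniteDimensional ℝ (Fin m → ℝ))

theorem norm_nonneg_aux {m : ℕ} (N : (Fin m → ℝ) → ℝ)
    (hN0 : ∀ z : Fin m → ℝ, N z = 0 ↔ z = 0)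
    (hNadd : ∀ u v : Fin m → ℝ, N (u + v) ≤ N u + N v)
    (hNsmul : ∀ (c : ℝ) (z : Fin m → ℝ), N (c • z) = |c| * N z) (z : Fin m → ℝ) :
    0 ≤ N z := by
  have h1 := hNadd z ((-1 : ℝ) • z)
  have h2 := hNsmul (-1) z
  have h3 : z + (-1 : ℝ) • z = 0 := by simp
  rw [h3, (hN0 0).2 rfl, h2] at h1
  norm_num at h1
  linarith

theorem norm_equiv_aux {m : ℕ} (N : (Fin m → ℝ) → ℝ)
    (hN0 : ∀ z : Fin m → ℝ, N z = 0 ↔ z = 0)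
    (hNadd : ∀ u v : Fin m → ℝ, N (u + v) ≤ N u + N v)
    (hNsmul : ∀ (c : ℝ) (z : Fin m → ℝ), N (c • z) = |c| * N z) :
    ∃ C : ℝ, 0 ≤ C ∧ ∀ z, ‖z‖ ≤ C * N z := by
  letI : Norm (NormCopy m) := ⟨N⟩
  have core : NormedSpace.Core ℝ (NormCopy m) :=
    { norm_nonneg := norm_nonneg_aux N hN0 hNadd hNsmul
      norm_smul := hNsmul
      norm_triangle := hNadd
      norm_eq_zero_iff := hN0 }
  letI : NormedAddCommGroup (NormCopy m) := NormedAddCommGroup.ofCore core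
  letI : NormedSpace ℝ (NormCopy m) := NormedSpace.ofCore core
  let f : NormCopy m →ₗ[ℝ] (Fin m → ℝ) :=
    { toFun := fun z => z, map_add' := fun _ _ => rfl, map_smul' := fun _ _ => rfl }
  let g : NormCopy m →L[ℝ] (Fin m → ℝ) := LinearMap.toContinuousLinearMap f
  exact ⟨‖g‖, norm_nonneg g, fun z => g.le_opNorm z⟩

/-- Let `r` be `L`-Lipschitz on the nonempty compact set `Ω` with respect to
a norm `N` on `ℝ^m`, and let `(x i)` be a sequence in `Ω` in which each point satisfies
all previously added norm-induced cuts. Then `(x i)` has at least one accumulation point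
in `Ω`, and every accumulation point `x*` is feasible, i.e. `r x* ≤ 0` componentwise. -/
theorem stmt_3
    {X : Type*} [NormedAddCommGroup X] [NormedSpace ℝ X] [FiniteDimensional ℝ X]
    {m : ℕ} (N : (Fin m → ℝ) → ℝ)
    (hN0 : ∀ z : Fin m → ℝ, N z = 0 ↔ z = 0)
    (hNadd : ∀ u v : Fin m → ℝ, N (u + v) ≤ N u + N v)
    (hNsmul : ∀ (c : ℝ) (z : Fin m → ℝ), N (c • z) = |c| * N z)
    (Ω : Set X) (hΩne : Ω.Nonempty) (hΩc : IsCompact Ω)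
    (r : X → Fin m → ℝ) (L : ℝ) (hL : 0 < L)
    (hLip : ∀ x ∈ Ω, ∀ y ∈ Ω, N (r x - r y) ≤ L * ‖x - y‖)
    (x : ℕ → X) (hxΩ : ∀ i, x i ∈ Ω)
    (hcut : ∀ i l : ℕ, i < l → N (fun j => max (r (x i) j) 0) / L ≤ ‖x l - x i‖) :
    (∃ xstar ∈ Ω, MapClusterPt xstar Filter.atTop x) ∧
      ∀ xstar, MapClusterPt xstar Filter.atTop x → ∀ j, r xstar j ≤ 0 := by
  obtain ⟨C, hC, hCN⟩ := norm_equiv_aux N hN0 hNadd hNsmul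
  constructor
  · obtain ⟨a, ha, φ, hφ, hlim⟩ := hΩc.tendsto_subseq hxΩ
    exact ⟨a, ha, (hlim.mapClusterPt).of_comp hφ.tendsto_atTop⟩
  · intro a hac j
    obtain ⟨φ, hφ, hlim⟩ := TopologicalSpace.FirstCountableTopology.tendsto_subseq hac
    have ha : a ∈ Ω := hΩc.isClosed.mem_of_tendsto hlim
      (Filter.Eventually.of_forall fun n => hxΩ _)
    have hlim' := hlim.comp (Filter.tendsto_add_atTop_nat 1)
    have h1 : Filter.Tendsto (fun n => C * (L * ‖a - x (φ n)‖)
        + C * (L * ‖x (φ (n + 1)) - x (φ n)‖)) Filter.atTop (nhds 0) := by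
      have e1 := (((tendsto_const_nhds (x := a)).sub hlim).norm.const_mul L).const_mul C
      have e2 := ((hlim'.sub hlim).norm.const_mul L).const_mul C
      simpa using e1.add e2
    refine ge_of_tendsto' h1 fun n => ?_
    have b1 : r a j - r (x (φ n)) j ≤ C * (L * ‖a - x (φ n)‖) :=
      calc r a j - r (x (φ n)) j ≤ ‖(r a - r (x (φ n))) j‖ := le_abs_self _
        _ ≤ ‖r a - r (x (φ n))‖ := norm_le_pi_norm _ j
        _ ≤ C * N (r a - r (x (φ n))) := hCN _
        _ ≤ _ := mul_le_mul_of_nonneg_left (hLip _ ha _ (hxΩ _)) hC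
    have b2 : r (x (φ n)) j ≤ C * (L * ‖x (φ (n + 1)) - x (φ n)‖) := by
      have h := hcut (φ n) (φ (n + 1)) (hφ (Nat.lt_succ_self n))
      rw [div_le_iff₀ hL, mul_comm] at h
      calc r (x (φ n)) j ≤ max (r (x (φ n)) j) 0 := le_max_left _ _
        _ ≤ ‖max (r (x (φ n)) j) 0‖ := le_abs_self _
        _ ≤ ‖fun j => max (r (x (φ n)) j) 0‖ :=
          norm_le_pi_norm (fun j => max (r (x (φ n)) j) 0) j
        _ ≤ C * N (fun j => max (r (x (φ n)) j) 0) := hCN _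
        _ ≤ _ := mul_le_mul_of_nonneg_left h hC
    linarith
end

section
/- Let X be a finite-dimensional real normed vector space, Ω ⊆ X a nonempty compact set, f : X → ℝ, and r : X → ℝ^m Lipschitz on Ω with constant L > 0 with respect to a monotone norm ‖·‖ on ℝ^m (if |u_i| ≤ |v_i| for all i then ‖u‖ ≤ ‖v‖). Let Q := {x ∈ Ω : r(x) ≤ 0} and let Q_k be the k-th relaxed set determined by points x⁰,…,x^{k−1} ∈ Ω with r(xⁱ) ≰ 0. If x^k is a global minimizer of f over Q_k and r(x^k) ≤ 0, then x^k is a global minimizer of f over Q. -/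
/-- If `xk` is a global minimizer of `f` over the `k`-th relaxed set `Q_k`
and `xk` is feasible (`r xk ≤ 0`), then `xk` is a global minimizer of `f` over the
feasible set `Q = {x ∈ Ω | r x ≤ 0}`. -/
theorem stmt_4
    {X : Type*} [NormedAddCommGroup X] [NormedSpace ℝ X] [FiniteDimensional ℝ X]
    {m : ℕ} (N : (Fin m → ℝ) → ℝ)
    (hN0 : ∀ z : Fin m → ℝ, N z = 0 ↔ z = 0)
    (hNadd : ∀ u v : Fin m → ℝ, N (u + v) ≤ N u + N v)
    (hNsmul : ∀ (c : ℝ) (z : Fin m → ℝ), N (c • z) = |c| * N z)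
    (hNmono : ∀ u v : Fin m → ℝ, (∀ i, |u i| ≤ |v i|) → N u ≤ N v)
    (Ω : Set X) (hΩne : Ω.Nonempty) (hΩc : IsCompact Ω)
    (f : X → ℝ)
    (r : X → Fin m → ℝ) (L : ℝ) (hL : 0 < L)
    (hLip : ∀ x ∈ Ω, ∀ y ∈ Ω, N (r x - r y) ≤ L * ‖x - y‖)
    (k : ℕ) (x : ℕ → X)
    (hxΩ : ∀ i < k, x i ∈ Ω)
    (hviol : ∀ i < k, ∃ j, 0 < r (x i) j)
    (xk : X)
    (hxkQk : xk ∈ {w ∈ Ω | ∀ i < k, N (fun j => max (r (x i) j) 0) / L ≤ ‖w - x i‖})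
    (hmin : ∀ w ∈ {w ∈ Ω | ∀ i < k, N (fun j => max (r (x i) j) 0) / L ≤ ‖w - x i‖},
      f xk ≤ f w)
    (hfeas : ∀ j, r xk j ≤ 0) :
    xk ∈ {w ∈ Ω | ∀ j, r w j ≤ 0} ∧
      ∀ w ∈ {w ∈ Ω | ∀ j, r w j ≤ 0}, f xk ≤ f w := by
  refine ⟨⟨hxkQk.1, hfeas⟩, fun w hw => hmin w ⟨hw.1, fun i hi => ?_⟩⟩
  rw [div_le_iff₀ hL, mul_comm]
  refine le_trans (hNmono _ (r w - r (x i)) fun j => ?_) (hLip w hw.1 (x i) (hxΩ i hi))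
  have h := hw.2 j
  rw [Pi.sub_apply, abs_of_nonneg (le_max_right _ _)]
  refine max_le ?_ (abs_nonneg _)
  have h2 := neg_le_abs (r w j - r (x i) j)
  linarith
end

section
/- Let X be a finite-dimensional real normed vector space, Ω ⊆ X a nonempty compact set, f : X → ℝ continuous, and r : X → ℝ^m Lipschitz on Ω with constant L > 0 with respect to a monotone norm ‖·‖ on ℝ^m (if |u_i| ≤ |v_i| for all i then ‖u‖ ≤ ‖v‖). Let Q := {x ∈ Ω : r(x) ≤ 0} be nonempty. Let (xⁱ)_{i∈ℕ} be a sequence in Ω such that r(xⁱ) ≰ 0 for all i, and such that each xⁱ is a global minimizer of f over the i-th relaxed set Q_i determined by the points x⁰,…,x^{i−1}. Then (xⁱ) has at least one accumulation point, and every accumulation point x* of (xⁱ) is a global minimizer of f over Q. -/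
/-- Suppose the feasible set `Q = {x ∈ Ω | r x ≤ 0}` is nonempty, `f` is
continuous, and `r` is `L`-Lipschitz on `Ω` with respect to a monotone norm `N` on `ℝ^m`.
If `(x i)` is a sequence such that `r (x i) ≰ 0` for all `i` and each `x i` is a global
minimizer of `f` over the `i`-th relaxed set `Q_i` (determined by `x 0, …, x (i-1)`),
then `(x i)` has at least one accumulation point, and every accumulation point `x*` is a
global minimizer of `f` over `Q`. -/
theorem stmt_5
    {X : Type*} [NormedAddCommGroup X] [NormedSpace ℝ X] [FiniteDimensional ℝ X]
    {m : ℕ} (N : (Fin m → ℝ) → ℝ)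
    (hN0 : ∀ z : Fin m → ℝ, N z = 0 ↔ z = 0)
    (hNadd : ∀ u v : Fin m → ℝ, N (u + v) ≤ N u + N v)
    (hNsmul : ∀ (c : ℝ) (z : Fin m → ℝ), N (c • z) = |c| * N z)
    (hNmono : ∀ u v : Fin m → ℝ, (∀ i, |u i| ≤ |v i|) → N u ≤ N v)
    (Ω : Set X) (hΩne : Ω.Nonempty) (hΩc : IsCompact Ω)
    (f : X → ℝ) (hf : Continuous f)
    (r : X → Fin m → ℝ) (L : ℝ) (hL : 0 < L)
    (hLip : ∀ x ∈ Ω, ∀ y ∈ Ω, N (r x - r y) ≤ L * ‖x - y‖)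
    (hQne : {w ∈ Ω | ∀ j, r w j ≤ 0}.Nonempty)
    (x : ℕ → X)
    (hviol : ∀ i, ∃ j, 0 < r (x i) j)
    (hmem : ∀ i : ℕ,
      x i ∈ {w ∈ Ω | ∀ l < i, N (fun j => max (r (x l) j) 0) / L ≤ ‖w - x l‖})
    (hmin : ∀ i : ℕ,
      ∀ w ∈ {w ∈ Ω | ∀ l < i, N (fun j => max (r (x l) j) 0) / L ≤ ‖w - x l‖},
        f (x i) ≤ f w) :
    (∃ xstar, MapClusterPt xstar Filter.atTop x) ∧
      ∀ xstar, MapClusterPt xstar Filter.atTop x →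
        xstar ∈ {w ∈ Ω | ∀ j, r w j ≤ 0} ∧
          ∀ w ∈ {w ∈ Ω | ∀ j, r w j ≤ 0}, f xstar ≤ f w := by
  have hmemΩ : ∀ i, x i ∈ Ω := fun i => (hmem i).1
  have hlow : ∀ w ∈ {w ∈ Ω | ∀ j, r w j ≤ 0}, ∀ i, f (x i) ≤ f w := by
    rintro w ⟨hw, hr⟩ i
    apply hmin i w
    refine ⟨hw, fun l _ => ?_⟩
    rw [div_le_iff₀ hL, norm_sub_rev, mul_comm]
    refine le_trans (hNmono _ _ fun j => ?_) (hLip _ (hmemΩ l) _ hw)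
    have := hr j
    rw [abs_of_nonneg (le_max_right _ _), Pi.sub_apply]
    exact max_le (le_trans (by linarith) (le_abs_self _)) (abs_nonneg _)
  refine ⟨?_, ?_⟩
  · obtain ⟨a, _, ha⟩ := hΩc.exists_mapClusterPt (f := Filter.atTop) (u := x)
      (Filter.le_principal_iff.2 (Filter.mem_map.2 (Filter.Eventually.of_forall hmemΩ)))
    exact ⟨a, ha⟩
  intro xs hxs
  have hfreq : ∀ ε > 0, ∀ n : ℕ, ∃ l, n ≤ l ∧ ‖x l - xs‖ < ε := by
    intro ε hε n
    have h := (mapClusterPt_iff_frequently.1 hxs) _ (Metric.ball_mem_nhds xs hε)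
    obtain ⟨l, hl, hb⟩ := Filter.frequently_atTop.1 h n
    exact ⟨l, hl, by rwa [Metric.mem_ball, dist_eq_norm] at hb⟩
  have hclosed : ∀ S : Set X, IsClosed S → (∀ i, x i ∈ S) → xs ∈ S := by
    intro S hS hx
    rw [← hS.closure_eq, Metric.mem_closure_iff]
    intro ε hε
    obtain ⟨l, _, hl⟩ := hfreq ε hε 0
    exact ⟨x l, hx l, by rwa [dist_comm, dist_eq_norm]⟩
  have hxsΩ : xs ∈ Ω := hclosed Ω hΩc.isClosed hmemΩ
  refine ⟨⟨hxsΩ, ?_⟩, fun w hw =>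
    hclosed {y | f y ≤ f w} (isClosed_le hf continuous_const) (hlow w hw)⟩
  have hle : N (fun j => max (r xs j) 0) ≤ 0 := by
    refine le_of_forall_pos_le_add fun δ hδ => ?_
    have hε : 0 < δ / (3 * L) := by positivity
    obtain ⟨l, _, hl⟩ := hfreq _ hε 0
    obtain ⟨i, hi, hib⟩ := hfreq _ hε (l + 1)
    have h1 := (hmem i).2 l hi
    rw [div_le_iff₀ hL] at h1
    have h2 : ‖x i - x l‖ ≤ ‖x i - xs‖ + ‖x l - xs‖ := by
      rw [norm_sub_rev (x l)]; exact norm_sub_le_norm_sub_add_norm_sub _ _ _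
    have h3 := hLip _ hxsΩ _ (hmemΩ l)
    rw [norm_sub_rev] at h3
    have h4 : N (fun j => |(r xs - r (x l)) j|) ≤ N (r xs - r (x l)) :=
      hNmono _ _ fun j => by rw [abs_abs]
    have h5 : N (fun j => max (r xs j) 0) ≤
        N ((fun j => max (r (x l) j) 0) + fun j => |(r xs - r (x l)) j|) := by
      refine hNmono _ _ fun j => ?_
      rw [abs_of_nonneg (le_max_right _ _)]
      refine le_trans ?_ (le_abs_self _)
      simp only [Pi.add_apply, Pi.sub_apply]
      have a1 := le_max_left (r (x l) j) 0
      have a2 := le_max_right (r (x l) j) 0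
      have a3 := le_abs_self (r xs j - r (x l) j)
      have a4 := abs_nonneg (r xs j - r (x l) j)
      exact max_le (by linarith) (by linarith)
    have h6 := hNadd (fun j => max (r (x l) j) 0) (fun j => |(r xs - r (x l)) j|)
    have h7 : δ = 3 * (L * (δ / (3 * L))) := by field_simp
    have h8 := mul_le_mul_of_nonneg_left hl.le hL.le
    have h9 := mul_le_mul_of_nonneg_left hib.le hL.le
    have h10 := mul_le_mul_of_nonneg_left h2 hL.le
    linarith
  have hge : 0 ≤ N (fun j => max (r xs j) 0) := by
    rw [← (hN0 0).2 rfl]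
    exact hNmono _ _ fun j => by simp
  have hz := (hN0 _).1 (le_antisymm hle hge)
  intro j
  have hj := congrFun hz j
  exact (le_max_left _ _).trans hj.le
end

section
/- Let X be a finite-dimensional real normed vector space, Ω ⊆ X a nonempty compact set, f : X → ℝ, and r : X → ℝ^m Lipschitz on Ω with constant L > 0 with respect to a monotone norm ‖·‖ on ℝ^m (if |u_i| ≤ |v_i| for all i then ‖u‖ ≤ ‖v‖). Let Q := {x ∈ Ω : r(x) ≤ 0} and let Q_k be the k-th relaxed set determined by points x⁰,…,x^{k−1} ∈ Ω with r(xⁱ) ≰ 0. If x^k is a local minimizer of f over Q_k (i.e., there is ε > 0 with f(x^k) ≤ f(x) for all x ∈ Q_k with ‖x − x^k‖ < ε) and r(x^k) ≤ 0, then x^k is a local minimizer of f over Q. -/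
/-- If `xk` is a local minimizer of `f` over the `k`-th relaxed set `Q_k`
and `xk` is feasible (`r xk ≤ 0`), then `xk` is a local minimizer of `f` over the
feasible set `Q = {x ∈ Ω | r x ≤ 0}`. -/
theorem stmt_6
    {X : Type*} [NormedAddCommGroup X] [NormedSpace ℝ X] [FiniteDimensional ℝ X]
    {m : ℕ} (N : (Fin m → ℝ) → ℝ)
    (hN0 : ∀ z : Fin m → ℝ, N z = 0 ↔ z = 0)
    (hNadd : ∀ u v : Fin m → ℝ, N (u + v) ≤ N u + N v)
    (hNsmul : ∀ (c : ℝ) (z : Fin m → ℝ), N (c • z) = |c| * N z)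
    (hNmono : ∀ u v : Fin m → ℝ, (∀ i, |u i| ≤ |v i|) → N u ≤ N v)
    (Ω : Set X) (hΩne : Ω.Nonempty) (hΩc : IsCompact Ω)
    (f : X → ℝ)
    (r : X → Fin m → ℝ) (L : ℝ) (hL : 0 < L)
    (hLip : ∀ x ∈ Ω, ∀ y ∈ Ω, N (r x - r y) ≤ L * ‖x - y‖)
    (k : ℕ) (x : ℕ → X)
    (hxΩ : ∀ i < k, x i ∈ Ω)
    (hviol : ∀ i < k, ∃ j, 0 < r (x i) j)
    (xk : X)
    (hxkQk : xk ∈ {w ∈ Ω | ∀ i < k, N (fun j => max (r (x i) j) 0) / L ≤ ‖w - x i‖})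
    (hlocmin : ∃ ε > (0 : ℝ),
      ∀ w ∈ {w ∈ Ω | ∀ i < k, N (fun j => max (r (x i) j) 0) / L ≤ ‖w - x i‖},
        ‖w - xk‖ < ε → f xk ≤ f w)
    (hfeas : ∀ j, r xk j ≤ 0) :
    xk ∈ {w ∈ Ω | ∀ j, r w j ≤ 0} ∧
      ∃ ε > (0 : ℝ), ∀ w ∈ {w ∈ Ω | ∀ j, r w j ≤ 0}, ‖w - xk‖ < ε → f xk ≤ f w := by
  obtain ⟨ε, hε, h⟩ := hlocmin
  refine ⟨⟨hxkQk.1, hfeas⟩, ε, hε, fun w hw hwε => h w ⟨hw.1, fun i hi => ?_⟩ hwε⟩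
  have h1 : N (fun j => max (r (x i) j) 0) ≤ N (r (x i) - r w) := by
    apply hNmono
    intro j
    have hj := hw.2 j
    rw [abs_of_nonneg (le_max_right _ _), Pi.sub_apply]
    refine max_le ?_ (abs_nonneg _)
    linarith [le_abs_self (r (x i) j - r w j)]
  have h2 := hLip (x i) (hxΩ i hi) w hw.1
  rw [div_le_iff₀ hL, norm_sub_rev, mul_comm]
  exact h1.trans h2
end

section
/- Let X be a finite-dimensional real normed vector space, Ω ⊆ X a nonempty compact set, and r : X → ℝ^m Lipschitz on Ω with constant L > 0 with respect to a norm ‖·‖ on ℝ^m. Suppose the problem is infeasible, i.e., every x ∈ Ω has r(x) ≰ 0. Then δ := min_{x∈Ω} ‖r(x)_+‖ exists and is strictly positive, and every sequence (xⁱ) in Ω in which each point satisfies all previously added norm-induced cuts (‖r(xⁱ)_+‖/L ≤ ‖x^l − xⁱ‖ for all i < l) is (δ/L)-separated: ‖x^l − xⁱ‖ ≥ δ/L for all i < l. -/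
/-- If the problem is infeasible, i.e. every `x ∈ Ω` has some strictly
positive component of `r x`, then `δ := min_{x ∈ Ω} N (r x)_+` exists and is strictly
positive, and every sequence in `Ω` in which each point satisfies all previously added
norm-induced cuts is `(δ/L)`-separated. -/
theorem stmt_7
    {X : Type*} [NormedAddCommGroup X] [NormedSpace ℝ X] [FiniteDimensional ℝ X]
    {m : ℕ} (N : (Fin m → ℝ) → ℝ)
    (hN0 : ∀ z : Fin m → ℝ, N z = 0 ↔ z = 0)
    (hNadd : ∀ u v : Fin m → ℝ, N (u + v) ≤ N u + N v)
    (hNsmul : ∀ (c : ℝ) (z : Fin m → ℝ), N (c • z) = |c| * N z)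
    (Ω : Set X) (hΩne : Ω.Nonempty) (hΩc : IsCompact Ω)
    (r : X → Fin m → ℝ) (L : ℝ) (hL : 0 < L)
    (hLip : ∀ x ∈ Ω, ∀ y ∈ Ω, N (r x - r y) ≤ L * ‖x - y‖)
    (hinfeas : ∀ x ∈ Ω, ∃ j, 0 < r x j) :
    ∃ δ : ℝ, 0 < δ ∧
      (∃ x0 ∈ Ω, N (fun j => max (r x0 j) 0) = δ) ∧
      (∀ x ∈ Ω, δ ≤ N (fun j => max (r x j) 0)) ∧
      ∀ (x : ℕ → X), (∀ i, x i ∈ Ω) →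
        (∀ i l : ℕ, i < l → N (fun j => max (r (x i) j) 0) / L ≤ ‖x l - x i‖) →
        ∀ i l : ℕ, i < l → δ / L ≤ ‖x l - x i‖ := by
  obtain ⟨y0, hy0⟩ := hΩne
  obtain ⟨j0, _⟩ := hinfeas y0 hy0
  have : Nonempty (Fin m) := ⟨j0⟩
  have hNneg : ∀ z, N (-z) = N z := fun z => by
    have := hNsmul (-1) z
    simpa using this
  have hNnn : ∀ z, 0 ≤ N z := fun z => by
    have h := hNadd z (-z)
    rw [hNneg, add_neg_cancel, (hN0 0).2 rfl] at h
    linarith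
  have hconv : ConvexOn ℝ Set.univ N := by
    refine ⟨convex_univ, fun x _ y _ a b ha hb _ => ?_⟩
    have h := hNadd (a • x) (b • y)
    rw [hNsmul, hNsmul, abs_of_nonneg ha, abs_of_nonneg hb] at h
    simpa using h
  have hcont : Continuous N := by
    have := hconv.continuousOn_interior
    rwa [interior_univ, continuousOn_univ] at this
  obtain ⟨c, hc, hcle⟩ : ∃ c : ℝ, 0 < c ∧ ∀ z, c * ‖z‖ ≤ N z := by
    obtain ⟨s, hs, hmin⟩ := (isCompact_sphere (0 : Fin m → ℝ) 1).exists_isMinOn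
      (NormedSpace.sphere_nonempty.2 zero_le_one) hcont.continuousOn
    have hs1 : ‖s‖ = 1 := by simpa using hs
    refine ⟨N s, lt_of_le_of_ne (hNnn s) fun h => ?_, fun z => ?_⟩
    · rw [(hN0 s).1 h.symm] at hs1
      simp at hs1
    · by_cases hz : z = 0
      · simp [hz, (hN0 0).2 rfl]
      · have hz' : 0 < ‖z‖ := norm_pos_iff.2 hz
        have h : N s ≤ N (‖z‖⁻¹ • z) := hmin (by simp [norm_smul, hz'.ne'])
        rw [hNsmul, abs_of_pos (inv_pos.2 hz')] at h
        calc N s * ‖z‖ ≤ (‖z‖⁻¹ * N z) * ‖z‖ := by gcongr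
          _ = N z := by field_simp
  have hr : ContinuousOn r Ω := by
    refine (LipschitzOnWith.of_dist_le_mul (K := (L / c).toNNReal) fun x hx y hy => ?_).continuousOn
    rw [Real.coe_toNNReal _ (by positivity), dist_eq_norm, dist_eq_norm, div_mul_eq_mul_div,
      le_div_iff₀ hc, mul_comm]
    exact (hcle _).trans (hLip x hx y hy)
  have hf : ContinuousOn (fun x => N (fun j => max (r x j) 0)) Ω := by
    refine hcont.comp_continuousOn (continuousOn_pi.2 fun j => ?_)
    exact ContinuousOn.sup (continuousOn_pi.1 hr j) continuousOn_const
  obtain ⟨x0, hx0, hmin⟩ := hΩc.exists_isMinOn ⟨y0, hy0⟩ hf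
  refine ⟨_, ?_, ⟨x0, hx0, rfl⟩, fun x hx => hmin hx, fun x hx hcut i l hil => ?_⟩
  · refine lt_of_le_of_ne (hNnn _) fun h => ?_
    obtain ⟨j, hj⟩ := hinfeas x0 hx0
    have := congrFun ((hN0 _).1 h.symm) j
    simp only [Pi.zero_apply] at this
    have := le_max_left (r x0 j) 0
    linarith
  · exact le_trans (div_le_div_of_nonneg_right (hmin (hx i)) hL.le) (hcut i l hil)
end

section
/- Let X be a finite-dimensional real normed vector space, Ω ⊆ X a nonempty compact set, r : X → ℝ^m a map, and ‖·‖ a monotone norm on ℝ^m (if |u_i| ≤ |v_i| for all i then ‖u‖ ≤ ‖v‖). Let Q := {x ∈ Ω : r(x) ≤ 0}. Suppose x⁰,…,x^{k−1} ∈ Ω satisfy r(xⁱ) ≰ 0, and for each i < k there exists a point-dependent Lipschitz constant L_i > 0 with ‖r(xⁱ) − r(y)‖ ≤ L_i ‖xⁱ − y‖_X for all y ∈ Ω. Then Q ⊆ {x ∈ Ω : ‖r(xⁱ)_+‖/L_i ≤ ‖x − xⁱ‖ for all i < k}; that is, the norm-induced cuts formed with the point-dependent constants L_i are still valid (do not cut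 off any feasible point). -/
/-- Norm-induced cuts formed with point-dependent Lipschitz constants
`L i` at the points `x i` are still valid: the feasible set `Q = {x ∈ Ω | r x ≤ 0}` is
contained in the relaxed set defined by these cuts. -/
theorem stmt_18
    {X : Type*} [NormedAddCommGroup X] [NormedSpace ℝ X] [FiniteDimensional ℝ X]
    {m : ℕ} (N : (Fin m → ℝ) → ℝ)
    (hN0 : ∀ z : Fin m → ℝ, N z = 0 ↔ z = 0)
    (hNadd : ∀ u v : Fin m → ℝ, N (u + v) ≤ N u + N v)
    (hNsmul : ∀ (c : ℝ) (z : Fin m → ℝ), N (c • z) = |c| * N z)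
    (hNmono : ∀ u v : Fin m → ℝ, (∀ i, |u i| ≤ |v i|) → N u ≤ N v)
    (Ω : Set X) (hΩne : Ω.Nonempty) (hΩc : IsCompact Ω)
    (r : X → Fin m → ℝ)
    (k : ℕ) (x : ℕ → X) (L : ℕ → ℝ)
    (hxΩ : ∀ i < k, x i ∈ Ω)
    (hviol : ∀ i < k, ∃ j, 0 < r (x i) j)
    (hLpos : ∀ i < k, 0 < L i)
    (hLip : ∀ i < k, ∀ y ∈ Ω, N (r (x i) - r y) ≤ L i * ‖x i - y‖) :
    {w ∈ Ω | ∀ j, r w j ≤ 0} ⊆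
      {w ∈ Ω | ∀ i < k, N (fun j => max (r (x i) j) 0) / L i ≤ ‖w - x i‖} := by
  rintro w ⟨hw, hr⟩
  refine ⟨hw, fun i hi => ?_⟩
  rw [div_le_iff₀ (hLpos i hi), norm_sub_rev, mul_comm]
  refine le_trans (hNmono _ _ fun j => ?_) (hLip i hi w hw)
  have h := hr j
  rw [abs_of_nonneg (le_max_right _ _), Pi.sub_apply]
  refine max_le ?_ (abs_nonneg _)
  exact le_trans (by linarith) (le_abs_self _)
end
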